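/- Let T > 0, let V : ℝⁿ → ℝ be smooth, let A : ℝⁿ → ℝ^{n×n} be smooth with A(x) symmetric positive definite for every x, and let p : [0,T] × ℝⁿ → (0,∞) be continuous, smooth on (0,T) × ℝⁿ, with each p_t a probability density, and satisfy the Fokker–Planck equation ∂_t p_t(x) = div( A(x) (∇ log p_t(x) + ∇V(x)) p_t(x) ) on (0,T) × ℝⁿ. Set ℓ_t(x) := p_t(x) e^{V(x)} and H(t) := ∫ p_t(x) log ℓ_t(x) dx. Assume: (i) for every t ∈ [0,T] the functions x ↦ p_t(x) log ℓ_t(x) and x ↦ ⟨∇ log ℓ_t(x), A(x) ∇ log ℓ_t(x)⟩ p_t(x) are Lebesgue integrable; (ii) H is continuous on [0,T] and differentiable on (0,T) with H′(t) = ∫ ∂_t( p_t(x) log ℓ_t(x) ) dx; (iii) for every t ∈ (0,T) the vector field x ↦ e^{−V(x)} (1 + log ℓ_t(x)) A(x) ∇ℓ_t(x) has Lebesgue-integrable divergence whose integral over ℝⁿ vanishes. Then the de Bruijn-type identity holds: for every t ∈ (0,T), d/dt H(t) = − I_G(P_t | Q), where I_G(P_t | Q) := ∫ ⟨ ∇ log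 ℓ_t(x) , A(x) ∇ log ℓ_t(x) ⟩ p_t(x) dx is the relative Fisher information associated with the metric tensor G = A⁻¹. -/

import Mathlib

open MeasureTheory Matrix

/-- Gradient of a scalar field on `ℝⁿ` (components are partial derivatives). -/
noncomputable def vgrad {n : ℕ} (f : (Fin n → ℝ) → ℝ) (x : Fin n → ℝ) : Fin n → ℝ :=
  fun i => fderiv ℝ f x (Pi.single i 1)

/-- Divergence of a vector field on `ℝⁿ`. -/
noncomputable def vdiv {n : ℕ} (v : (Fin n → ℝ) → Fin n → ℝ) (x : Fin n → ℝ) : ℝ :=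
  ∑ i, fderiv ℝ (fun y => v y i) x (Pi.single i 1)

/-- Product rule for the divergence of a scalar multiple of a vector field. -/
theorem vdiv_smul {n : ℕ} {f : (Fin n → ℝ) → ℝ} {v : (Fin n → ℝ) → Fin n → ℝ}
    {x : Fin n → ℝ} (hf : DifferentiableAt ℝ f x)
    (hv : ∀ i, DifferentiableAt ℝ (fun y => v y i) x) :
    vdiv (fun y => f y • v y) x = f x * vdiv v x + vgrad f x ⬝ᵥ v x := by
  simp only [vdiv, vgrad, dotProduct, Pi.smul_apply, smul_eq_mul, Finset.mul_sum]
  rw [← Finset.sum_add_distrib]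
  refine Finset.sum_congr rfl fun i _ => ?_
  rw [fderiv_fun_mul hf (hv i)]
  simp [mul_comm]

theorem vgrad_add {n : ℕ} {f g : (Fin n → ℝ) → ℝ} {x : Fin n → ℝ}
    (hf : DifferentiableAt ℝ f x) (hg : DifferentiableAt ℝ g x) :
    vgrad (fun y => f y + g y) x = vgrad f x + vgrad g x := by
  ext i
  simp [vgrad, fderiv_fun_add hf hg]

theorem vgrad_log {n : ℕ} {f : (Fin n → ℝ) → ℝ} {x : Fin n → ℝ}
    (hf : DifferentiableAt ℝ f x) (h0 : f x ≠ 0) :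
    vgrad (fun y => Real.log (f y)) x = (f x)⁻¹ • vgrad f x := by
  ext i
  simp [vgrad, fderiv.log hf h0]

theorem differentiable_vgrad {n : ℕ} {f : (Fin n → ℝ) → ℝ}
    (hf : ContDiff ℝ (⊤ : ℕ∞) f) (i : Fin n) : Differentiable ℝ fun x => vgrad f x i :=
  ((hf.fderiv_right (m := (⊤ : ℕ∞)) (by simp)).clm_apply contDiff_const).differentiable
    (by simp)

/-- A vector field `p A ∇L` with `p` differentiable and `A`, `L` smooth has differentiable
components. -/
theorem differentiable_smul_mulVec_vgrad {n : ℕ} {A : (Fin n → ℝ) → Matrix (Fin n) (Fin n) ℝ}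
    (hA : ∀ i j, ContDiff ℝ (⊤ : ℕ∞) fun x => A x i j) {p L : (Fin n → ℝ) → ℝ}
    (hp : Differentiable ℝ p) (hL : ContDiff ℝ (⊤ : ℕ∞) L) (i : Fin n) :
    Differentiable ℝ fun x => (p x • (A x *ᵥ vgrad L x)) i := by
  simp only [Pi.smul_apply, smul_eq_mul, mulVec, dotProduct]
  refine hp.mul (Differentiable.fun_sum fun j _ => ?_)
  exact ((hA i j).differentiable (by simp)).mul (differentiable_vgrad hL j)

/-- de Bruijn-type identity: `d/dt H(t) = −I_G(P_t|Q)`, where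
`I_G(P_t|Q) = ∫ ⟨∇ log ℓ_t, A ∇ log ℓ_t⟩ p_t dx` is the relative Fisher information
associated with the metric tensor `G = A⁻¹`. -/
theorem stmt_12 {n : ℕ} (T : ℝ) (hT : 0 < T)
    (V : (Fin n → ℝ) → ℝ) (hV : ContDiff ℝ (⊤ : ℕ∞) V)
    (A : (Fin n → ℝ) → Matrix (Fin n) (Fin n) ℝ)
    (hA : ∀ i j, ContDiff ℝ (⊤ : ℕ∞) fun x => A x i j)
    (hsym : ∀ x, (A x).IsSymm) (hpd : ∀ x, (A x).PosDef)
    (p : ℝ → (Fin n → ℝ) → ℝ)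
    (hpcont : ContinuousOn (fun q : ℝ × (Fin n → ℝ) => p q.1 q.2)
      (Set.Icc 0 T ×ˢ Set.univ))
    (hpsm : ContDiffOn ℝ (⊤ : ℕ∞) (fun q : ℝ × (Fin n → ℝ) => p q.1 q.2)
      (Set.Ioo 0 T ×ˢ Set.univ))
    (hppos : ∀ t ∈ Set.Icc (0:ℝ) T, ∀ x, 0 < p t x)
    (hprob : ∀ t ∈ Set.Icc (0:ℝ) T, Integrable (p t) ∧ ∫ x, p t x = 1)
    (hFP : ∀ t ∈ Set.Ioo (0:ℝ) T, ∀ x : Fin n → ℝ,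
      deriv (fun s => p s x) t
        = vdiv (fun y =>
            p t y • (A y *ᵥ (vgrad (fun z => Real.log (p t z)) y + vgrad V y))) x)
    -- the likelihood ratio ℓ_t(x) = p_t(x) e^{V(x)}
    (ℓ : ℝ → (Fin n → ℝ) → ℝ) (hℓ : ∀ t x, ℓ t x = p t x * Real.exp (V x))
    -- the relative entropy H(t) = ∫ p_t log ℓ_t dx
    (H : ℝ → ℝ) (hH : ∀ t, H t = ∫ x, p t x * Real.log (ℓ t x))
    -- (i) integrability of the entropy and Fisher-information integrands
    (hi : ∀ t ∈ Set.Icc (0:ℝ) T,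
      Integrable (fun x => p t x * Real.log (ℓ t x)) ∧
      Integrable (fun x =>
        (vgrad (fun z => Real.log (ℓ t z)) x ⬝ᵥ
          (A x *ᵥ vgrad (fun z => Real.log (ℓ t z)) x)) * p t x))
    -- (ii) H is continuous on [0,T] and differentiable on (0,T), with derivative obtained
    -- by differentiating under the integral sign
    (hii₁ : ContinuousOn H (Set.Icc 0 T))
    (hii₂ : ∀ t ∈ Set.Ioo (0:ℝ) T,
      HasDerivAt H (∫ x, deriv (fun s => p s x * Real.log (ℓ s x)) t) t)
    -- (iii) the divergence of x ↦ e^{−V}(1 + log ℓ_t) Σ ∇ℓ_t is integrable with vanishing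
    -- integral
    (hiii : ∀ t ∈ Set.Ioo (0:ℝ) T,
      Integrable (fun x => vdiv (fun y =>
        (Real.exp (-V y) * (1 + Real.log (ℓ t y))) • (A y *ᵥ vgrad (ℓ t) y)) x) ∧
      ∫ x, vdiv (fun y =>
        (Real.exp (-V y) * (1 + Real.log (ℓ t y))) • (A y *ᵥ vgrad (ℓ t) y)) x = 0) :
    ∀ t ∈ Set.Ioo (0:ℝ) T,
      HasDerivAt H
        (-(∫ x, (vgrad (fun z => Real.log (ℓ t z)) x ⬝ᵥ
            (A x *ᵥ vgrad (fun z => Real.log (ℓ t z)) x)) * p t x)) t := by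
  intro t ht
  have htI := Set.Ioo_subset_Icc_self ht
  have hopen : IsOpen (Set.Ioo 0 T ×ˢ (Set.univ : Set (Fin n → ℝ))) := isOpen_Ioo.prod isOpen_univ
  have hpsmAt : ∀ x, ContDiffAt ℝ (⊤ : ℕ∞) (fun q : ℝ × (Fin n → ℝ) => p q.1 q.2) (t, x) :=
    fun x => hpsm.contDiffAt (hopen.mem_nhds ⟨ht, Set.mem_univ x⟩)
  have hp : ContDiff ℝ (⊤ : ℕ∞) (p t) := contDiff_iff_contDiffAt.2 fun x =>
    (hpsmAt x).comp x (contDiffAt_const.prodMk contDiffAt_id)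
  have hpos : ∀ x, p t x ≠ 0 := fun x => (hppos t htI x).ne'
  have hpd' : Differentiable ℝ (p t) := hp.differentiable (by simp)
  have hVd : Differentiable ℝ V := hV.differentiable (by simp)
  have hlogp : ContDiff ℝ (⊤ : ℕ∞) fun x => Real.log (p t x) := hp.log hpos
  have hlog : ∀ s ∈ Set.Ioo 0 T, ∀ x, Real.log (ℓ s x) = Real.log (p s x) + V x :=
    fun s hs x => by
      rw [hℓ, Real.log_mul (hppos s (Set.Ioo_subset_Icc_self hs) x).ne' (Real.exp_pos _).ne',
        Real.log_exp]
  have hL : ContDiff ℝ (⊤ : ℕ∞) fun x => Real.log (ℓ t x) := by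
    simpa only [hlog t ht] using hlogp.add hV
  have hLgrad : ∀ x, vgrad (fun z => Real.log (ℓ t z)) x
      = vgrad (fun z => Real.log (p t z)) x + vgrad V x := fun x => by
    simp only [hlog t ht]
    exact vgrad_add (hlogp.differentiable (by simp) x) (hVd x)
  have hℓd : Differentiable ℝ (ℓ t) := by
    rw [funext (hℓ t)]
    exact hpd'.mul hVd.exp
  have hℓne : ∀ x, ℓ t x ≠ 0 := fun x => by
    rw [hℓ]
    exact mul_ne_zero (hpos x) (Real.exp_pos _).ne'
  have hfield : ∀ y, (Real.exp (-V y) * (1 + Real.log (ℓ t y))) • (A y *ᵥ vgrad (ℓ t) y)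
      = (1 + Real.log (ℓ t y)) • (p t y • (A y *ᵥ vgrad (fun z => Real.log (ℓ t z)) y)) :=
    fun y => by
      rw [vgrad_log (hℓd y) (hℓne y), mulVec_smul, smul_smul, smul_smul]
      congr 1
      rw [hℓ, Real.exp_neg]
      field_simp [hpos y]
  have hkey : ∀ x, deriv (fun s => p s x * Real.log (ℓ s x)) t
      = vdiv (fun y =>
          (Real.exp (-V y) * (1 + Real.log (ℓ t y))) • (A y *ᵥ vgrad (ℓ t) y)) x
        - (vgrad (fun z => Real.log (ℓ t z)) x ⬝ᵥ
            (A x *ᵥ vgrad (fun z => Real.log (ℓ t z)) x)) * p t x := fun x => by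
    have hpt : HasDerivAt (fun s => p s x) (deriv (fun s => p s x) t) t :=
      (DifferentiableAt.comp (f := fun s => (s, x)) t ((hpsmAt x).differentiableAt (by simp))
        (differentiableAt_id.prodMk (differentiableAt_const x))).hasDerivAt
    have hent : deriv (fun s => p s x * Real.log (ℓ s x)) t
        = (1 + Real.log (ℓ t x)) * deriv (fun s => p s x) t := by
      have hev : (fun s => p s x * Real.log (ℓ s x))
          =ᶠ[nhds t] fun s => p s x * (Real.log (p s x) + V x) := by
        filter_upwards [Ioo_mem_nhds ht.1 ht.2] with s hs
        rw [hlog s hs]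
      rw [hev.deriv_eq, (hpt.fun_mul ((hpt.log (hpos x)).add_const (V x))).deriv, hlog t ht]
      field_simp [hpos x]
      ring
    rw [hent, hFP t ht x]
    simp only [hfield, ← hLgrad]
    rw [vdiv_smul ((hL.differentiable (by simp) x).const_add 1)
      (fun i => differentiable_smul_mulVec_vgrad hA hpd' hL i x)]
    have hgrad : vgrad (fun y => 1 + Real.log (ℓ t y)) x
        = vgrad (fun y => Real.log (ℓ t y)) x := by
      ext i
      simp [vgrad]
    rw [hgrad, dotProduct_smul, smul_eq_mul]
    ring
  have hH' := hii₂ t ht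
  simp only [hkey] at hH'
  rwa [integral_sub (hiii t ht).1 (hi t htI).2, (hiii t ht).2, zero_sub] at hH'
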